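/- Consider the joint state (orientation, gyro bias, velocity, accel bias, position, point P_f ∈ ℝ³, line (δθ_L ∈ ℝ³, δφ_L ∈ ℝ)) of dimension 22. Let g, P_f, P₁, V₁, P_k ∈ ℝ³, δt ∈ ℝ, R₁ a rotation matrix; let (n_L, v_L) be Plücker line coordinates (nonzero, n_Lᵀv_L = 0) with w₁, w₂, n_e, v_e, η², R_L = [n_e, v_e, n_e×v_e] as usual; let Γ₂, Γ₄, Γ_{l2}, Γ_{l3} ∈ ℝ³ˣ³ be arbitrary and H ∈ ℝ²ˣ³ satisfy H(n_L − ⌊P_k×⌋v_L) = 0. Define the point block row M_p = [Γ₁, Γ₂, −δtI₃, Γ₄, −I₃, I₃, 0₃ₓ₃, 0₃ₓ₁] with Γ₁ = ⌊(P_f − P₁ − V₁δt + ½δt²g)×⌋R₁, and the line block row M_l = H·[Γ_{l1}, Γ_{l2}, δt⌊v_L×⌋, Γ_{l3}, ⌊v_L×⌋, 0₃ₓ₃, Γ_{l4}, Γ_{l5}]. Let N_{pl} ∈ ℝ²²ˣ⁴ have column 1 = (R₁ᵀg; 0; −⌊V₁×⌋g; 0; −⌊P₁×⌋g; −⌊P_f×⌋g;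 −g; 0) and columns 2–4 given by stacked blocks (0; 0; 0; 0; I₃; I₃; (w₂/w₁)v_e·e₁ᵀR_Lᵀ; η²w₂²·e₃ᵀR_Lᵀ). Then M_p·N_{pl} = 0 and M_l·N_{pl} = 0. Hence the linearized aided INS with one point and one line feature has at least 4 unobservable directions. -/

import Mathlib

open Matrix

noncomputable section

abbrev V3 : Type := Fin 3 → ℝ
abbrev M3 : Type := Matrix (Fin 3) (Fin 3) ℝ

/-- The skew-symmetric cross-product matrix `⌊v×⌋`. -/
def skew (v : V3) : M3 :=
  !![0, -(v 2), v 1; v 2, 0, -(v 0); -(v 1), v 0, 0]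

/-- `R` is a rotation matrix: `RᵀR = I₃` and `det R = 1`. -/
def IsRot (R : M3) : Prop := Rᵀ * R = 1 ∧ R.det = 1

/-- Euclidean norm on `ℝ³`. -/
def norm3 (v : V3) : ℝ := Real.sqrt (v ⬝ᵥ v)

def e1 : V3 := ![1, 0, 0]
def e2 : V3 := ![0, 1, 0]
def e3 : V3 := ![0, 0, 1]

/-- The 3×3 matrix with the given columns. -/
def cols3 (a b c : V3) : M3 := Matrix.of fun i j => ![a i, b i, c i] j

/-- The 3×3 matrix with the given rows. -/
def rows3 (a b c : V3) : M3 := Matrix.of ![a, b, c]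

/-- 22-dimensional joint state index
(orientation, gyro bias, velocity, accel bias, position, point, δθ_L, δφ_L). -/
abbrev S22 : Type := Fin 3 ⊕ Fin 3 ⊕ Fin 3 ⊕ Fin 3 ⊕ Fin 3 ⊕ Fin 3 ⊕ Fin 3 ⊕ Fin 1

/-- The 3×22 block row `[A B C D E F G w]` (last block a column vector). -/
def row7v (A B C D E F G : M3) (w : V3) : Matrix (Fin 3) S22 ℝ :=
  Matrix.of fun i =>
    Sum.elim (fun j => A i j) (Sum.elim (fun j => B i j) (Sum.elim (fun j => C i j)
      (Sum.elim (fun j => D i j) (Sum.elim (fun j => E i j)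
        (Sum.elim (fun j => F i j) (Sum.elim (fun j => G i j) (fun _ => w i)))))))

/-- The stacked vector `(a; b; c; d; e; f; g; s)` in ℝ²². -/
def col8 (a b c d e f g : V3) (s : ℝ) : S22 → ℝ :=
  Sum.elim a (Sum.elim b (Sum.elim c (Sum.elim d (Sum.elim e
    (Sum.elim f (Sum.elim g (fun _ => s)))))))

/-- The 22×3 stacked blocks `(A; B; C; D; E; F; G; r)` (last block a row vector). -/
def stack8 (A B C D E F G : M3) (r : V3) : Matrix S22 (Fin 3) ℝ :=
  Matrix.of (Sum.elim (fun i => A i) (Sum.elim (fun i => B i) (Sum.elim (fun i => C i)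
    (Sum.elim (fun i => D i) (Sum.elim (fun i => E i)
      (Sum.elim (fun i => F i) (Sum.elim (fun i => G i) (fun _ => r))))))))


theorem row7v_mulVec_col8 (A B C D E F G : M3) (w a b c d e f g : V3) (s : ℝ) :
    row7v A B C D E F G w *ᵥ col8 a b c d e f g s =
      A *ᵥ a + B *ᵥ b + C *ᵥ c + D *ᵥ d + E *ᵥ e + F *ᵥ f + G *ᵥ g + s • w := by
  ext i
  simp [row7v, col8, mulVec, dotProduct, Fintype.sum_sum_type]
  ring

theorem row7v_mul_stack8 (A B C D E F G A' B' C' D' E' F' G' : M3) (w r : V3) :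
    row7v A B C D E F G w * stack8 A' B' C' D' E' F' G' r =
      A * A' + B * B' + C * C' + D * D' + E * E' + F * F' + G * G' + vecMulVec w r := by
  ext i j
  simp [row7v, stack8, Matrix.mul_apply, Fintype.sum_sum_type, vecMulVec_apply]
  ring

theorem skew_mulVec (v u : V3) : skew v *ᵥ u = v ⨯₃ u := by
  ext i
  fin_cases i <;> simp [skew, mulVec, dotProduct, Fin.sum_univ_three, cross_apply] <;> ring

theorem skew_cross (u v : V3) : skew (u ⨯₃ v) = vecMulVec v u - vecMulVec u v := by
  ext i j
  fin_cases i <;> fin_cases j <;>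
    simp [skew, cross_apply, vecMulVec_apply] <;> ring

theorem skew_smul (c : ℝ) (v : V3) : skew (c • v) = c • skew v := by
  ext i j
  fin_cases i <;> fin_cases j <;> simp [skew]

theorem norm3_sq (v : V3) : norm3 v ^ 2 = v ⬝ᵥ v :=
  Real.sq_sqrt (Finset.sum_nonneg fun i _ => mul_self_nonneg (v i))

theorem norm3_ne_zero {v : V3} (hv : v ≠ 0) : norm3 v ≠ 0 := by
  intro h
  have h2 := norm3_sq v
  rw [h] at h2
  exact hv (dotProduct_self_eq_zero.1 (by simpa using h2.symm))

theorem cols3_transpose (a b c : V3) : (cols3 a b c)ᵀ = rows3 a b c := by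
  ext i j
  fin_cases i <;> rfl

theorem vecMulVec_e1_mul_rows3 (u a b c : V3) :
    vecMulVec u e1 * rows3 a b c = vecMulVec u a := by
  ext i j
  simp [Matrix.mul_apply, vecMulVec_apply, e1, rows3, Fin.sum_univ_three]

theorem e3_vecMul_rows3 (a b c : V3) : e3 ᵥ* rows3 a b c = c := by
  ext j
  simp [vecMul, dotProduct, e3, rows3, Fin.sum_univ_three]

theorem point_row_mulVec_gravity_direction (g Pf P V : V3) (t : ℝ) :
    skew (Pf - P - t • V + (t ^ 2 / 2) • g) *ᵥ g + t • (skew V *ᵥ g) + skew P *ᵥ g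
      - skew Pf *ᵥ g = 0 := by
  simp only [skew_mulVec, map_add, map_sub, map_smul, LinearMap.add_apply, LinearMap.sub_apply,
    LinearMap.smul_apply, cross_self]
  module

/-- The Jacobi identity in matrix form. -/
theorem skew_skew_mulVec (u v : V3) :
    skew (skew u *ᵥ v) = skew u * skew v - skew v * skew u := by
  rw [skew_mulVec]
  ext i j
  fin_cases i <;> fin_cases j <;>
    simp [skew, cross_apply] <;> ring

theorem norm3_sq_smul_skew {n v : V3} (h : n ⬝ᵥ v = 0) :
    norm3 n ^ 2 • skew v = vecMulVec n (skew n *ᵥ v) - vecMulVec (skew n *ᵥ v) n := by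
  rw [norm3_sq, ← skew_smul, skew_mulVec, ← skew_cross]
  congr 1
  simp only [dotProduct, Fin.sum_univ_three] at h
  ext i
  fin_cases i <;> simp [cross_apply, dotProduct, Fin.sum_univ_three]
  · linear_combination (n 0) * h
  · linear_combination (n 1) * h
  · linear_combination (n 2) * h

/-- the linearized aided INS with one point and one line feature has at
least 4 unobservable directions. -/
theorem point_line_unobservable_directions
    (nL vL g Pf P₁ V₁ Pk : V3) (δt : ℝ) (R₁ : M3) (hR₁ : IsRot R₁)
    (hnL : nL ≠ 0) (hvL : vL ≠ 0) (horth : nL ⬝ᵥ vL = 0)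
    (Γ₂ Γ₄ Γl2 Γl3 : M3) (H : Matrix (Fin 2) (Fin 3) ℝ)
    (hH : H *ᵥ (nL - skew Pk *ᵥ vL) = 0) :
    let w₁ : ℝ := norm3 nL
    let w₂ : ℝ := norm3 vL
    let nE : V3 := w₁⁻¹ • nL
    let vE : V3 := w₂⁻¹ • vL
    let ηsq : ℝ := (w₁ ^ 2 + w₂ ^ 2)⁻¹
    let RL : M3 := cols3 nE vE (skew nE *ᵥ vE)
    let Γ₁ : M3 := skew (Pf - P₁ - δt • V₁ + (δt ^ 2 / 2) • g) * R₁
    let Γl1 : M3 := (skew nL - skew (skew Pk *ᵥ vL) + skew vL * skew P₁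
        + δt • (skew vL * skew V₁) - (δt ^ 2 / 2) • (skew vL * skew g)
        - skew vL * skew Pk) * R₁
    let Γl4 : M3 := skew nL - skew Pk * skew vL
    let Γl5 : V3 := -((w₂ / w₁) • nL + (w₁ / w₂) • (skew Pk *ᵥ vL))
    let Mp : Matrix (Fin 3) S22 ℝ :=
      row7v Γ₁ Γ₂ ((-δt) • (1 : M3)) Γ₄ (-1) 1 0 0
    let Ml : Matrix (Fin 2) S22 ℝ :=
      H * row7v Γl1 Γl2 (δt • skew vL) Γl3 (skew vL) 0 Γl4 Γl5
    let Npl : Matrix S22 (Fin 1 ⊕ Fin 3) ℝ :=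
      Matrix.of fun s => Sum.elim
        (fun _ : Fin 1 =>
          col8 (R₁ᵀ *ᵥ g) 0 (-(skew V₁ *ᵥ g)) 0 (-(skew P₁ *ᵥ g))
            (-(skew Pf *ᵥ g)) (-g) 0 s)
        (fun j : Fin 3 => stack8 0 0 0 0 1 1
          (((w₂ / w₁) • vecMulVec vE e1) * RLᵀ) ((ηsq * w₂ ^ 2) • (e3 ᵥ* RLᵀ)) s j)
    Mp * Npl = 0 ∧ Ml * Npl = 0 := by
  have hw₁ := norm3_ne_zero hnL
  have hw₂ := norm3_ne_zero hvL
  have hR : R₁ * R₁ᵀ = 1 := mul_eq_one_comm.1 hR₁.1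
  intro w₁ w₂ nE vE ηsq RL Γ₁ Γl1 Γl4 Γl5 Mp Ml Npl
  replace hw₁ : w₁ ≠ 0 := hw₁
  replace hw₂ : w₂ ≠ 0 := hw₂
  have hN : Npl = fromCols
      (replicateCol (Fin 1) (col8 (R₁ᵀ *ᵥ g) 0 (-(skew V₁ *ᵥ g)) 0 (-(skew P₁ *ᵥ g))
        (-(skew Pf *ᵥ g)) (-g) 0))
      (stack8 0 0 0 0 1 1
        (((w₂ / w₁) • vecMulVec vE e1) * RLᵀ) ((ηsq * w₂ ^ 2) • (e3 ᵥ* RLᵀ))) := by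
    ext s (j | j) <;> rfl
  have hRL : RLᵀ = rows3 nE vE (skew nE *ᵥ vE) := cols3_transpose _ _ _
  have hRg (A : M3) : (A * R₁) *ᵥ (R₁ᵀ *ᵥ g) = A *ᵥ g := by
    rw [mulVec_mulVec, Matrix.mul_assoc, hR, Matrix.mul_one]
  have hPv (u : V3) : skew vL *ᵥ skew Pk *ᵥ u =
      skew Pk *ᵥ skew vL *ᵥ u - skew (skew Pk *ᵥ vL) *ᵥ u := by
    rw [skew_skew_mulVec, sub_mulVec, mulVec_mulVec, mulVec_mulVec]
    abel
  rw [hN, mul_fromCols, mul_fromCols, ← fromCols_zero, ← fromCols_zero, fromCols_ext_iff,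
    fromCols_ext_iff, ← replicateCol_mulVec, ← replicateCol_mulVec, replicateCol_eq_zero,
    replicateCol_eq_zero]
  refine ⟨⟨?_, ?_⟩, ?_, ?_⟩
  · rw [row7v_mulVec_col8, hRg]
    refine Eq.trans ?_ (point_row_mulVec_gravity_direction g Pf P₁ V₁ δt)
    simp only [mulVec_zero, smul_mulVec, neg_mulVec, one_mulVec, mulVec_neg, zero_mulVec,
      zero_smul]
    module
  · rw [row7v_mul_stack8]
    simp
  · have hrow : row7v Γl1 Γl2 (δt • skew vL) Γl3 (skew vL) 0 Γl4 Γl5 *ᵥ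
        col8 (R₁ᵀ *ᵥ g) 0 (-(skew V₁ *ᵥ g)) 0 (-(skew P₁ *ᵥ g))
          (-(skew Pf *ᵥ g)) (-g) 0 = 0 := by
      have hg : skew g *ᵥ g = 0 := by rw [skew_mulVec, cross_self]
      rw [row7v_mulVec_col8, hRg]
      simp only [Γl4, add_mulVec, sub_mulVec, smul_mulVec, ← mulVec_mulVec, mulVec_zero,
        mulVec_neg, zero_mulVec, zero_smul, hPv, hg]
      module
    rw [← mulVec_mulVec, hrow, mulVec_zero]
  · have hHP : H *ᵥ (skew Pk *ᵥ vL) = H *ᵥ nL := by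
      rw [mulVec_sub] at hH
      exact (sub_eq_zero.1 hH).symm
    have hskew : skew vL = (w₁ ^ 2)⁻¹ •
        (vecMulVec nL (skew nL *ᵥ vL) - vecMulVec (skew nL *ᵥ vL) nL) := by
      rw [← norm3_sq_smul_skew horth, smul_smul, inv_mul_cancel₀ (pow_ne_zero 2 hw₁), one_smul]
    have hvv : skew vL *ᵥ vL = 0 := by rw [skew_mulVec, cross_self]
    have hΓl4 : Γl4 *ᵥ vE = w₂⁻¹ • (skew nL *ᵥ vL) := by
      simp only [Γl4, vE, mulVec_smul, sub_mulVec, ← mulVec_mulVec, hvv, mulVec_zero, sub_zero]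
    have hm : skew nE *ᵥ vE = (w₂⁻¹ * w₁⁻¹) • (skew nL *ᵥ vL) := by
      simp only [nE, vE, skew_smul, smul_mulVec, mulVec_smul, smul_smul]
    have hΓl5 : H *ᵥ Γl5 = -(w₂ / w₁ + w₁ / w₂) • (H *ᵥ nL) := by
      simp only [Γl5, mulVec_neg, mulVec_add, mulVec_smul, hHP]
      module
    have hη : w₁ ^ 2 + w₂ ^ 2 ≠ 0 := by positivity
    rw [Matrix.mul_assoc, row7v_mul_stack8, hRL, Matrix.smul_mul (w₂ / w₁), vecMulVec_e1_mul_rows3,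
      e3_vecMul_rows3, Matrix.mul_smul, mul_vecMulVec, hΓl4, hm]
    simp only [Matrix.mul_zero, Matrix.mul_one, Matrix.mul_add, mul_vecMulVec, hΓl5, hskew,
      Matrix.mul_sub, Matrix.mul_smul, mulVec_smul, nE]
    ext i j
    simp [-mulVec_mulVec, vecMulVec_apply, ηsq]
    field_simp
    ring
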